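/- arXiv:2304.00478 — 4 statements merged into one kernel-verified Lean document; each statement's English description precedes it below -/
import Mathlib

section
/- Let w be a vector in Euclidean space ℝⁿ with ‖w‖ < 1, set ρ := 1 − ‖w‖², and define F(y) := (√(⟨y,w⟩² + ρ‖y‖²) − ⟨y,w⟩)/ρ. Then for every vector y, F(y) = 1 if and only if ‖y − w‖ = 1; that is, the indicatrix {y : F(y) = 1} of F is exactly the unit sphere centered at w. -/
open RealInnerProductSpace

/-- The indicatrix of `F` is the unit sphere centered at `w`:
`F(y) = 1 ↔ ‖y − w‖ = 1`. -/
theorem zermelo_F_indicatrix {n : ℕ} (w : EuclideanSpace ℝ (Fin n)) (hw : ‖w‖ < 1)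
    (ρ : ℝ) (hρ : ρ = 1 - ‖w‖ ^ 2)
    (F : EuclideanSpace ℝ (Fin n) → ℝ)
    (hF : ∀ y, F y = (Real.sqrt (⟪y, w⟫ ^ 2 + ρ * ‖y‖ ^ 2) - ⟪y, w⟫) / ρ)
    (y : EuclideanSpace ℝ (Fin n)) :
    F y = 1 ↔ ‖y - w‖ = 1 := by
  have hρ0 : 0 < ρ := by
    have : ‖w‖ ^ 2 < 1 := by nlinarith [norm_nonneg w]
    linarith
  have hsphere : ‖y - w‖ = 1 ↔ ‖y‖ ^ 2 = ρ + 2 * ⟪y, w⟫ := by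
    rw [← sq_eq_sq₀ (norm_nonneg _) zero_le_one, norm_sub_sq_real]
    constructor <;> intro h <;> linarith
  rw [hsphere, hF, div_eq_one_iff_eq hρ0.ne', sub_eq_iff_eq_add]
  constructor
  · intro h
    have hS : ⟪y, w⟫ ^ 2 + ρ * ‖y‖ ^ 2 = (ρ + ⟪y, w⟫) ^ 2 := by
      rw [← h, Real.sq_sqrt (by positivity)]
    apply mul_left_cancel₀ hρ0.ne'
    linear_combination hS
  · intro h
    rw [Real.sqrt_eq_iff_mul_self_eq (by positivity) (by nlinarith [sq_nonneg ‖y‖])]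
    linear_combination ρ * h
end

section
/- Let w be a vector in Euclidean space ℝⁿ with ‖w‖ < 1, set ρ := 1 − ‖w‖², and define F(y) := (√(⟨y,w⟩² + ρ‖y‖²) − ⟨y,w⟩)/ρ. Then F equals the Minkowski gauge (gauge functional) of the closed unit ball centered at w: for every y, F(y) = gauge (Metric.closedBall w 1) y. -/
open RealInnerProductSpace

theorem inv_smul_mem_closedBall_one_iff {E : Type*} [SeminormedAddCommGroup E]
    [InnerProductSpace ℝ E] (w y : E) {t : ℝ} (ht : 0 < t) :
    t⁻¹ • y ∈ Metric.closedBall w 1 ↔ ‖y‖ ^ 2 - 2 * t * ⟪y, w⟫ ≤ (1 - ‖w‖ ^ 2) * t ^ 2 := by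
  have key : ‖t⁻¹ • y - w‖ = t⁻¹ * ‖y - t • w‖ := by
    rw [← norm_smul_of_nonneg (inv_nonneg.2 ht.le), smul_sub, inv_smul_smul₀ ht.ne']
  rw [mem_closedBall_iff_norm, key, inv_mul_le_one₀ ht, ← sq_le_sq₀ (norm_nonneg _) ht.le,
    norm_sub_sq_real, real_inner_smul_right, norm_smul_of_nonneg ht.le]
  constructor <;> intro h <;> linarith

theorem sub_le_mul_sq_iff_root_le {ρ a b t : ℝ} (hρ : 0 < ρ) (ha : 0 ≤ a) (ht : 0 < t) :
    a - 2 * t * b ≤ ρ * t ^ 2 ↔ (√(b ^ 2 + ρ * a) - b) / ρ ≤ t := by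
  have hs : |b| ≤ √(b ^ 2 + ρ * a) := Real.abs_le_sqrt (by nlinarith)
  have hpos : 0 < t * ρ := mul_pos ht hρ
  have hroot : -√(b ^ 2 + ρ * a) ≤ b := (abs_le.1 hs).1
  rw [div_le_iff₀ hρ]
  constructor
  · intro h
    have h' : √(b ^ 2 + ρ * a) ≤ |t * ρ + b| := Real.sqrt_le_iff.2
      ⟨abs_nonneg _, by rw [sq_abs]; nlinarith [mul_le_mul_of_nonneg_left h hρ.le]⟩
    rcases le_abs.1 h' with h' | h' <;> linarith
  · intro h
    rw [sub_le_iff_le_add, Real.sqrt_le_iff] at h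
    exact le_of_mul_le_mul_left (by nlinarith [h.2]) hρ

/-- The gauge of a closed unit ball whose center `w` has norm less than `1`. -/
theorem gauge_closedBall_one_eq {E : Type*} [SeminormedAddCommGroup E]
    [InnerProductSpace ℝ E] {w : E} (hw : ‖w‖ < 1) (y : E) :
    gauge (Metric.closedBall w 1) y =
      (√(⟪y, w⟫ ^ 2 + (1 - ‖w‖ ^ 2) * ‖y‖ ^ 2) - ⟪y, w⟫) / (1 - ‖w‖ ^ 2) := by
  have hρ : 0 < 1 - ‖w‖ ^ 2 := by nlinarith [norm_nonneg w]
  have hmem : ∀ t : ℝ, 0 < t → (t⁻¹ • y ∈ Metric.closedBall w 1 ↔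
      (√(⟪y, w⟫ ^ 2 + (1 - ‖w‖ ^ 2) * ‖y‖ ^ 2) - ⟪y, w⟫) / (1 - ‖w‖ ^ 2) ≤ t) := fun t ht ↦
    (inv_smul_mem_closedBall_one_iff w y ht).trans (sub_le_mul_sq_iff_root_le hρ (sq_nonneg _) ht)
  have hnonneg : 0 ≤ (√(⟪y, w⟫ ^ 2 + (1 - ‖w‖ ^ 2) * ‖y‖ ^ 2) - ⟪y, w⟫) / (1 - ‖w‖ ^ 2) :=
    div_nonneg (sub_nonneg.2 (Real.le_sqrt_of_sq_le (by nlinarith [sq_nonneg ‖y‖]))) hρ.le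
  rw [gauge_def']
  refine csInf_eq_of_forall_ge_of_forall_gt_exists_lt ?_ (fun t ht ↦ (hmem t ht.1).1 ht.2) ?_
  · have ht := add_pos_of_nonneg_of_pos hnonneg one_pos
    exact ⟨_, ht, (hmem _ ht).2 (le_add_of_nonneg_right zero_le_one)⟩
  · intro u hu
    obtain ⟨t, ht, htu⟩ := exists_between hu
    exact ⟨t, ⟨hnonneg.trans_lt ht, (hmem t (hnonneg.trans_lt ht)).2 ht.le⟩, htu⟩

/-- `F` equals the Minkowski gauge of the closed unit ball centered at `w`. -/
theorem zermelo_F_eq_gauge {n : ℕ} (w : EuclideanSpace ℝ (Fin n)) (hw : ‖w‖ < 1)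
    (ρ : ℝ) (hρ : ρ = 1 - ‖w‖ ^ 2)
    (F : EuclideanSpace ℝ (Fin n) → ℝ)
    (hF : ∀ y, F y = (Real.sqrt (⟪y, w⟫ ^ 2 + ρ * ‖y‖ ^ 2) - ⟪y, w⟫) / ρ)
    (y : EuclideanSpace ℝ (Fin n)) :
    F y = gauge (Metric.closedBall w 1) y := by
  rw [hF, hρ, gauge_closedBall_one_eq hw]
end

section
/- Let w be a vector in Euclidean space ℝⁿ with ‖w‖ < 1, set ρ := 1 − ‖w‖², and define F(y) := (√(⟨y,w⟩² + ρ‖y‖²) − ⟨y,w⟩)/ρ. Let p, q ∈ ℝⁿ, T > 0, and let γ : ℝ → ℝⁿ be continuously differentiable on [0,T] with γ(0) = p and γ(T) = q. Then ∫₀ᵀ F(γ'(t)) dt ≥ F(q − p); moreover the straight segment γ₀(t) := p + (t/T)•(q − p) attains equality, ∫₀ᵀ F(γ₀'(t)) dt = F(q − p). Hence for a constant external field the straight line is the F-length minimizing (optimal) trajectory. -/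
open RealInnerProductSpace

section RandersNorm

variable {E : Type*} [NormedAddCommGroup E] [InnerProductSpace ℝ E]

/-- The linear map `y ↦ (⟪y, w⟫, √ρ • y)` into the `L²` product, whose norm is the
Riemannian part of the Randers metric. -/
noncomputable def randersEmbedding (w : E) (ρ : ℝ) : E →L[ℝ] WithLp 2 (ℝ × E) :=
  (WithLp.prodContinuousLinearEquiv 2 ℝ ℝ E).symm.toContinuousLinearMap.comp
    ((innerSL ℝ w).prod (√ρ • ContinuousLinearMap.id ℝ E))

theorem norm_randersEmbedding (w : E) {ρ : ℝ} (hρ : 0 ≤ ρ) (y : E) :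
    ‖randersEmbedding w ρ y‖ = √(⟪y, w⟫ ^ 2 + ρ * ‖y‖ ^ 2) := by
  rw [WithLp.prod_norm_eq_of_L2]
  simp [randersEmbedding, norm_smul, mul_pow, Real.sq_sqrt hρ, real_inner_comm]

/-- A `C¹` curve is at least as long, for the Randers metric, as its chord. -/
theorem randers_chord_le_integral [CompleteSpace E] (w : E) {ρ : ℝ} (hρ : 0 ≤ ρ)
    {a b : ℝ} (hab : a ≤ b) {γ γ' : ℝ → E}
    (hderiv : ∀ t ∈ Set.Icc a b, HasDerivAt γ (γ' t) t)
    (hcont : ContinuousOn γ' (Set.Icc a b)) :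
    (‖randersEmbedding w ρ (γ b - γ a)‖ - ⟪γ b - γ a, w⟫) / ρ ≤
      ∫ t in a..b, (‖randersEmbedding w ρ (γ' t)‖ - ⟪γ' t, w⟫) / ρ := by
  rw [← Set.uIcc_of_le hab] at hderiv hcont
  have hint : IntervalIntegrable γ' MeasureTheory.volume a b := hcont.intervalIntegrable
  have hA : ∫ t in a..b, randersEmbedding w ρ (γ' t) = randersEmbedding w ρ (γ b - γ a) := by
    rw [ContinuousLinearMap.intervalIntegral_comp_comm _ hint,
      intervalIntegral.integral_eq_sub_of_hasDerivAt hderiv hint]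
  have hw : ∫ t in a..b, ⟪γ' t, w⟫ = ⟪γ b - γ a, w⟫ := by
    have := (innerSL ℝ w).intervalIntegral_comp_comm hint
    rw [intervalIntegral.integral_eq_sub_of_hasDerivAt hderiv hint] at this
    simpa only [innerSL_apply_apply, real_inner_comm] using this
  have hintA : IntervalIntegrable (fun t => ‖randersEmbedding w ρ (γ' t)‖)
      MeasureTheory.volume a b :=
    ((randersEmbedding w ρ).continuous.comp_continuousOn hcont).norm.intervalIntegrable
  have hintw : IntervalIntegrable (fun t => ⟪γ' t, w⟫) MeasureTheory.volume a b :=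
    (hcont.inner continuousOn_const).intervalIntegrable
  rw [intervalIntegral.integral_div, intervalIntegral.integral_sub hintA hintw, hw, ← hA]
  gcongr
  exact intervalIntegral.norm_integral_le_integral_norm hab

end RandersNorm

/-- for any C¹ curve from `p` to `q` on `[0,T]`, the `F`-length is at least
`F(q − p)`, and the straight segment `γ₀(t) = p + (t/T)•(q − p)` attains equality; so for a
constant external field the straight line is the `F`-length minimizing (optimal) trajectory. -/
theorem zermelo_straight_line_optimal {n : ℕ} (w : EuclideanSpace ℝ (Fin n)) (hw : ‖w‖ < 1)
    (ρ : ℝ) (hρ : ρ = 1 - ‖w‖ ^ 2)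
    (F : EuclideanSpace ℝ (Fin n) → ℝ)
    (hF : ∀ y, F y = (Real.sqrt (⟪y, w⟫ ^ 2 + ρ * ‖y‖ ^ 2) - ⟪y, w⟫) / ρ)
    (p q : EuclideanSpace ℝ (Fin n)) (T : ℝ) (hT : 0 < T)
    (γ γ' : ℝ → EuclideanSpace ℝ (Fin n))
    (hp : γ 0 = p) (hq : γ T = q)
    (hderiv : ∀ t ∈ Set.Icc (0 : ℝ) T, HasDerivAt γ (γ' t) t)
    (hcont : ContinuousOn γ' (Set.Icc (0 : ℝ) T)) :
    F (q - p) ≤ (∫ t in (0 : ℝ)..T, F (γ' t)) ∧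
      (∫ t in (0 : ℝ)..T, F (deriv (fun s => p + (s / T) • (q - p)) t)) = F (q - p) := by
  have hρ0 : 0 ≤ ρ := by nlinarith [norm_nonneg w]
  have hF' : ∀ y, F y = (‖randersEmbedding w ρ y‖ - ⟪y, w⟫) / ρ := fun y => by
    rw [hF, norm_randersEmbedding w hρ0]
  constructor
  · simpa only [hF', hp, hq] using randers_chord_le_integral w hρ0 hT.le hderiv hcont
  · have hd : ∀ t : ℝ, deriv (fun s : ℝ => p + (s / T) • (q - p)) t = T⁻¹ • (q - p) := fun t => by
      have h := (((hasDerivAt_id t).div_const T).smul_const (q - p)).const_add p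
      simpa using h.deriv
    simp only [hd, intervalIntegral.integral_const, hF', map_smul, norm_smul, norm_inv,
      Real.norm_of_nonneg hT.le, real_inner_smul_left, sub_zero, smul_eq_mul]
    field_simp
end

section
/- Let w be a vector in Euclidean space ℝⁿ with ‖w‖ < 1, set ρ := 1 − ‖w‖², and define F(y) := (√(⟨y,w⟩² + ρ‖y‖²) − ⟨y,w⟩)/ρ. Let p, q ∈ ℝⁿ with p ≠ q, let T > 0, and let γ : ℝ → ℝⁿ be continuously differentiable on [0,T] with γ(0) = p, γ(T) = q, and ‖γ'(t) − w‖ = 1 for all t ∈ [0,T]. Then T ≥ F(q − p). That is, F(q − p) is a lower bound for the travel time from p to q of any admissible trajectory in Zermelo's navigation problem with constant field w. -/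
open RealInnerProductSpace

/-- Shen's navigation metric of `y` is at most `T` whenever `y` lies in the closed ball of radius
`T` around `T • w`, the set reachable in time `T` with unit own speed and drift `w`. -/
theorem zermelo_metric_le_of_norm_sub_smul_le {E : Type*} [NormedAddCommGroup E]
    [InnerProductSpace ℝ E] {w y : E} {T : ℝ} (hw : ‖w‖ < 1) (hT : 0 ≤ T)
    (hy : ‖y - T • w‖ ≤ T) :
    (Real.sqrt (⟪y, w⟫ ^ 2 + (1 - ‖w‖ ^ 2) * ‖y‖ ^ 2) - ⟪y, w⟫) / (1 - ‖w‖ ^ 2) ≤ T := by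
  have hρ : 0 < 1 - ‖w‖ ^ 2 := by nlinarith [norm_nonneg w]
  have hsq : ‖y‖ ^ 2 - 2 * (T * ⟪y, w⟫) + T ^ 2 * ‖w‖ ^ 2 ≤ T ^ 2 := by
    have h := pow_le_pow_left₀ (norm_nonneg _) hy 2
    rwa [norm_sub_sq_real, real_inner_smul_right, norm_smul, mul_pow, Real.norm_eq_abs,
      sq_abs] at h
  have hnonneg : 0 ≤ T * (1 - ‖w‖ ^ 2) + ⟪y, w⟫ := by
    have h := neg_le_of_abs_le (abs_real_inner_le_norm (y - T • w) w)
    rw [inner_sub_left, real_inner_smul_left, real_inner_self_eq_norm_sq] at h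
    have hle : ‖y - T • w‖ * ‖w‖ ≤ T :=
      (mul_le_mul hy hw.le (norm_nonneg w) hT).trans_eq (mul_one T)
    linarith
  rw [div_le_iff₀ hρ, sub_le_iff_le_add]
  refine Real.sqrt_le_iff.mpr ⟨hnonneg, ?_⟩
  nlinarith [mul_le_mul_of_nonneg_left hsq hρ.le]

/-- `F(q − p)` is a lower bound for the travel time from `p` to `q` of any
admissible trajectory (unit own-speed control plus drift `w`) in Zermelo's navigation
problem with constant field `w`. -/
theorem zermelo_travel_time_lower_bound {n : ℕ} (w : EuclideanSpace ℝ (Fin n)) (hw : ‖w‖ < 1)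
    (ρ : ℝ) (hρ : ρ = 1 - ‖w‖ ^ 2)
    (F : EuclideanSpace ℝ (Fin n) → ℝ)
    (hF : ∀ y, F y = (Real.sqrt (⟪y, w⟫ ^ 2 + ρ * ‖y‖ ^ 2) - ⟪y, w⟫) / ρ)
    (p q : EuclideanSpace ℝ (Fin n)) (hpq : p ≠ q) (T : ℝ) (hT : 0 < T)
    (γ γ' : ℝ → EuclideanSpace ℝ (Fin n))
    (hp : γ 0 = p) (hq : γ T = q)
    (hderiv : ∀ t ∈ Set.Icc (0 : ℝ) T, HasDerivAt γ (γ' t) t)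
    (hcont : ContinuousOn γ' (Set.Icc (0 : ℝ) T))
    (hctrl : ∀ t ∈ Set.Icc (0 : ℝ) T, ‖γ' t - w‖ = 1) :
    F (q - p) ≤ T := by
  have hdisp : ‖(q - p) - T • w‖ ≤ T := by
    have h := (convex_Icc (0 : ℝ) T).norm_image_sub_le_of_norm_hasDerivWithin_le
      (f := fun t => γ t - t • w) (f' := fun t => γ' t - (1 : ℝ) • w) (C := 1)
      (fun t ht => ((hderiv t ht).sub ((hasDerivAt_id t).smul_const w)).hasDerivWithinAt)
      (fun t ht => by rw [one_smul]; exact (hctrl t ht).le)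
      (Set.left_mem_Icc.mpr hT.le) (Set.right_mem_Icc.mpr hT.le)
    simp only [hp, hq, zero_smul, sub_zero, one_mul, Real.norm_of_nonneg hT.le] at h
    rwa [sub_right_comm] at h
  exact hF (q - p) ▸ hρ ▸ zermelo_metric_le_of_norm_sub_smul_le hw hT.le hdisp
end
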